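/- arXiv:1103.3199 — 2 statements merged into one kernel-verified Lean document; each statement's English description precedes it below -/
import Mathlib

section
/- Let λ > 1 be a real number and let φ be a C^∞ diffeomorphism from an open neighbourhood of the origin in ℝ² onto an open subset of ℝ² with φ(0) = 0 and D₀φ = Id. Then there exist an open neighbourhood V of 0, a C^∞ diffeomorphism ψ from V onto an open neighbourhood of 0 with ψ(0) = 0 and D₀ψ = Id, and an open neighbourhood U of 0 such that ψ(φ(x)) = λ⁻¹ · ψ(λ · x) for all x ∈ U. (Equivalently, the germ of φ at 0 is the commutator [ψ⁻¹, A_λ⁻¹] of the germ of ψ⁻¹ and the germ of the inverse of the scalar map A_λ : x ↦ λx.) -/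
open scoped ContDiff

/-- `φ` is a `C^∞` diffeomorphism from the open set `U ⊆ ℝ²` onto an open subset of `ℝ²`:
`U` is open, `φ` is `C^∞` on `U`, injective on `U`, the image `φ '' U` is open, and there is a
`C^∞` inverse on the image. -/
def IsSmoothDiffeoOn (φ : EuclideanSpace ℝ (Fin 2) → EuclideanSpace ℝ (Fin 2))
    (U : Set (EuclideanSpace ℝ (Fin 2))) : Prop :=
  IsOpen U ∧ ContDiffOn ℝ ∞ φ U ∧ Set.InjOn φ U ∧ IsOpen (φ '' U) ∧
    ∃ χ : EuclideanSpace ℝ (Fin 2) → EuclideanSpace ℝ (Fin 2),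
      ContDiffOn ℝ ∞ χ (φ '' U) ∧ ∀ x ∈ U, χ (φ x) = x

open Filter Topology Metric Set

/-- `g` is smooth on the open neighbourhood `U` of the fixed point `0`, with linear part
`c • id` there. -/
structure IsSmoothWithScalarPart {E : Type*} [NormedAddCommGroup E] [NormedSpace ℝ E]
    (c : ℝ) (g : E → E) (U : Set E) : Prop where
  isOpen : IsOpen U
  zero_mem : (0 : E) ∈ U
  contDiffOn : ContDiffOn ℝ ∞ g U
  map_zero : g 0 = 0
  hasFDerivAt_zero : HasFDerivAt g (c • ContinuousLinearMap.id ℝ E) 0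

/-- The renormalized iterates `c⁻ⁿ gⁿ`, whose limit linearizes `g`. -/
noncomputable def koenigsIterate {E : Type*} [NormedAddCommGroup E] [NormedSpace ℝ E]
    (c : ℝ) (g : E → E) (n : ℕ) (x : E) : E :=
  (c⁻¹) ^ n • g^[n] x

/-- The action of `g` on tangent vectors. -/
noncomputable def tangentExtension {E : Type*} [NormedAddCommGroup E] [NormedSpace ℝ E]
    (g : E → E) (p : E × E) : E × E :=
  (g p.1, fderiv ℝ g p.1 p.2)

theorem norm_iterate_le_of_forall_mem_ball {E : Type*} [SeminormedAddCommGroup E] {g : E → E}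
    {r q : ℝ} (hq0 : 0 ≤ q) (hq1 : q ≤ 1)
    (hg : ∀ x ∈ ball (0 : E) r, ‖g x‖ ≤ q * ‖x‖) {x : E} (hx : x ∈ ball (0 : E) r) (n : ℕ) :
    ‖g^[n] x‖ ≤ q ^ n * ‖x‖ := by
  induction n with
  | zero => simp
  | succ n ih =>
    rw [Function.iterate_succ_apply']
    have hmem : g^[n] x ∈ ball (0 : E) r := by
      rw [mem_ball_zero_iff] at *
      exact (ih.trans (mul_le_of_le_one_left (norm_nonneg x) (pow_le_one₀ hq0 hq1))).trans_lt hx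
    calc ‖g (g^[n] x)‖ ≤ q * ‖g^[n] x‖ := hg _ hmem
      _ ≤ q * (q ^ n * ‖x‖) := by gcongr
      _ = q ^ (n + 1) * ‖x‖ := by ring

namespace IsSmoothWithScalarPart

universe u

variable {E : Type u} [NormedAddCommGroup E] [NormedSpace ℝ E] {c : ℝ} {g : E → E} {U : Set E}

theorem contDiffAt (h : IsSmoothWithScalarPart c g U) {x : E} (hx : x ∈ U) :
    ContDiffAt ℝ ∞ g x :=
  h.contDiffOn.contDiffAt (h.isOpen.mem_nhds hx)

theorem differentiableAt (h : IsSmoothWithScalarPart c g U) {x : E} (hx : x ∈ U) :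
    DifferentiableAt ℝ g x :=
  (h.contDiffAt hx).differentiableAt (by simp)

theorem contDiffOn_fderiv (h : IsSmoothWithScalarPart c g U) :
    ContDiffOn ℝ ∞ (fderiv ℝ g) U :=
  h.contDiffOn.fderiv_of_isOpen h.isOpen (by simp)

theorem tangent (h : IsSmoothWithScalarPart c g U) :
    IsSmoothWithScalarPart c (tangentExtension g) (U ×ˢ univ) where
  isOpen := h.isOpen.prod isOpen_univ
  zero_mem := ⟨h.zero_mem, mem_univ _⟩
  contDiffOn := by
    have hfst : ContDiffOn ℝ ∞ (Prod.fst : E × E → E) (U ×ˢ univ) := contDiff_fst.contDiffOn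
    have hmaps : MapsTo (Prod.fst : E × E → E) (U ×ˢ univ) U := fun p hp => hp.1
    exact (h.contDiffOn.comp hfst hmaps).prodMk
      ((h.contDiffOn_fderiv.comp hfst hmaps).clm_apply contDiff_snd.contDiffOn)
  map_zero := by simp [tangentExtension, h.map_zero]
  hasFDerivAt_zero := by
    have h1 : HasFDerivAt (fun p : E × E => g p.1)
        ((c • ContinuousLinearMap.id ℝ E).comp (ContinuousLinearMap.fst ℝ E E)) 0 :=
      HasFDerivAt.comp (0 : E × E) (f := Prod.fst) h.hasFDerivAt_zero hasFDerivAt_fst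
    have h2 : DifferentiableAt ℝ (fderiv ℝ g) 0 :=
      (h.contDiffOn_fderiv.contDiffAt (h.isOpen.mem_nhds h.zero_mem)).differentiableAt (by simp)
    have h3 : HasFDerivAt (fun p : E × E => fderiv ℝ g p.1)
        ((fderiv ℝ (fderiv ℝ g) 0).comp (ContinuousLinearMap.fst ℝ E E)) 0 :=
      HasFDerivAt.comp (0 : E × E) (f := Prod.fst) h2.hasFDerivAt hasFDerivAt_fst
    have h4 := h1.prodMk (h3.clm_apply hasFDerivAt_snd)
    refine h4.congr_fderiv ?_
    ext v <;> simp [h.hasFDerivAt_zero.fderiv]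

theorem exists_norm_sub_le (h : IsSmoothWithScalarPart c g U) :
    ∃ r > 0, ball (0 : E) r ⊆ U ∧ ∃ K ≥ 0, ∀ x ∈ ball (0 : E) r,
      ‖g x - c • x‖ ≤ K * ‖x‖ ^ 2 := by
  have hnhds := h.isOpen.mem_nhds h.zero_mem
  obtain ⟨K, t, ht, hK⟩ := ((h.contDiffOn_fderiv.contDiffAt hnhds).of_le
    (by simp : (1 : WithTop ℕ∞) ≤ ∞)).exists_lipschitzOnWith
  obtain ⟨r, hr, hsub⟩ := Metric.mem_nhds_iff.1 (inter_mem ht hnhds)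
  refine ⟨r, hr, fun x hx => (hsub hx).2, K, K.2, fun x hx => ?_⟩
  have hle : ∀ y ∈ closedBall (0 : E) ‖x‖, y ∈ ball (0 : E) r := fun y hy => by
    simp only [mem_closedBall, mem_ball, dist_zero_right] at *
    exact hy.trans_lt hx
  have hmv := (convex_closedBall (0 : E) ‖x‖).norm_image_sub_le_of_norm_hasFDerivWithin_le
    (f := fun y => g y - c • y) (f' := fun y => fderiv ℝ g y - c • ContinuousLinearMap.id ℝ E)
    (C := K * ‖x‖) (x := 0) (y := x) (fun y hy => ?_) (fun y hy => ?_) (by simp) (by simp)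
  · simpa [h.map_zero, mul_assoc, sq] using hmv
  · exact ((h.differentiableAt (hsub (hle y hy)).2).hasFDerivAt.sub
      ((hasFDerivAt_id y).const_smul c)).hasFDerivWithinAt
  · have := hK.dist_le_mul y (hsub (hle y hy)).1 0 (hsub (mem_ball_self hr)).1
    rw [h.hasFDerivAt_zero.fderiv, dist_eq_norm, dist_zero_right] at this
    exact this.trans (by gcongr; simpa using hy)

theorem exists_contraction (h : IsSmoothWithScalarPart c g U) (hc0 : 0 < c) (hc1 : c < 1) :
    ∃ r > 0, ball (0 : E) r ⊆ U ∧ ∃ q, 0 ≤ q ∧ q < 1 ∧ c⁻¹ * q ^ 2 < 1 ∧ ∃ K ≥ 0,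
      ∀ x ∈ ball (0 : E) r, ‖g x‖ ≤ q * ‖x‖ ∧ ‖g x - c • x‖ ≤ K * ‖x‖ ^ 2 := by
  obtain ⟨r, hr, hU, K, hK, hg⟩ := h.exists_norm_sub_le
  have hcs : c < √c := Real.lt_sqrt_of_sq_lt (by nlinarith)
  obtain ⟨q, hcq, hqs⟩ := exists_between hcs
  have hq0 : 0 < q := hc0.trans hcq
  have hq2 : q ^ 2 < c := (Real.lt_sqrt hq0.le).1 hqs
  refine ⟨min r ((q - c) / (K + 1)), lt_min hr (by have := sub_pos.2 hcq; positivity),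
    (ball_subset_ball (min_le_left _ _)).trans hU, q, hq0.le, by nlinarith, ?_, K, hK,
    fun x hx => ⟨?_, hg x (ball_subset_ball (min_le_left _ _) hx)⟩⟩
  · rwa [inv_mul_lt_one₀ hc0]
  · have h1 := hg x (ball_subset_ball (min_le_left _ _) hx)
    have h2 : ‖x‖ < (q - c) / (K + 1) := by
      simpa using ball_subset_ball (min_le_right _ _) hx
    rw [lt_div_iff₀ (by positivity)] at h2
    have h3 : ‖g x‖ ≤ ‖g x - c • x‖ + ‖c • x‖ := by
      simpa using norm_add_le (g x - c • x) (c • x)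
    rw [norm_smul, Real.norm_of_nonneg hc0.le] at h3
    nlinarith [norm_nonneg x]

/-- The renormalized iterates of a contraction with scalar linear part converge uniformly near
the fixed point, to a map tangent to the identity. -/
theorem exists_tendstoUniformlyOn [CompleteSpace E] (h : IsSmoothWithScalarPart c g U)
    (hc0 : 0 < c) (hc1 : c < 1) :
    ∃ r > 0, ball (0 : E) r ⊆ U ∧ MapsTo g (ball 0 r) (ball 0 r) ∧
      (∀ x ∈ ball (0 : E) r, Tendsto (fun n => g^[n] x) atTop (𝓝 0)) ∧
      ∃ ψ : E → E, TendstoUniformlyOn (koenigsIterate c g) ψ atTop (ball 0 r) ∧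
        HasFDerivAt ψ (ContinuousLinearMap.id ℝ E) 0 := by
  obtain ⟨r, hr, hU, q, hq0, hq1, hcq, K, hK, hg⟩ := h.exists_contraction hc0 hc1
  have hit : ∀ x ∈ ball (0 : E) r, ∀ n, ‖g^[n] x‖ ≤ q ^ n * ‖x‖ := fun x hx n =>
    norm_iterate_le_of_forall_mem_ball hq0 hq1.le (fun y hy => (hg y hy).1) hx n
  have hmaps : MapsTo g (ball 0 r) (ball 0 r) := fun x hx => by
    have := (hg x hx).1
    rw [mem_ball_zero_iff] at *
    nlinarith [norm_nonneg x]
  set C : ℝ := c⁻¹ * K with hC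
  set d : ℝ := c⁻¹ * q ^ 2 with hd
  have hC0 : 0 ≤ C := by positivity
  have hd0 : 0 ≤ d := by positivity
  have hstep : ∀ x ∈ ball (0 : E) r, ∀ n,
      dist (koenigsIterate c g n x) (koenigsIterate c g (n + 1) x) ≤ C * ‖x‖ ^ 2 * d ^ n := by
    intro x hx n
    have h1 := (hg _ (hmaps.iterate n hx)).2
    have h2 : koenigsIterate c g (n + 1) x - koenigsIterate c g n x =
        (c⁻¹) ^ (n + 1) • (g (g^[n] x) - c • g^[n] x) := by
      rw [koenigsIterate, koenigsIterate, Function.iterate_succ_apply', smul_sub, smul_smul,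
        pow_succ, inv_mul_cancel_right₀ hc0.ne']
    rw [dist_comm, dist_eq_norm, h2, norm_smul, norm_pow, norm_inv, Real.norm_of_nonneg hc0.le]
    calc (c⁻¹) ^ (n + 1) * ‖g (g^[n] x) - c • g^[n] x‖
        ≤ (c⁻¹) ^ (n + 1) * (K * (q ^ n * ‖x‖) ^ 2) := by
          gcongr
          exact h1.trans (by gcongr; exact hit x hx n)
      _ = C * ‖x‖ ^ 2 * d ^ n := by rw [hC, hd]; ring
  have hlim : ∀ x, ∃ y, x ∈ ball (0 : E) r →
      Tendsto (fun n => koenigsIterate c g n x) atTop (𝓝 y) := fun x => by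
    by_cases hx : x ∈ ball (0 : E) r
    · obtain ⟨y, hy⟩ := cauchySeq_tendsto_of_complete
        (cauchySeq_of_le_geometric d _ hcq (hstep x hx))
      exact ⟨y, fun _ => hy⟩
    · exact ⟨0, fun h => absurd h hx⟩
  choose ψ hψ using hlim
  refine ⟨r, hr, hU, hmaps, fun x hx => ?_, ψ, ?_, ?_⟩
  · refine squeeze_zero_norm (hit x hx) ?_
    simpa using (tendsto_pow_atTop_nhds_zero_of_lt_one hq0 hq1).mul_const ‖x‖
  · have hbound : Tendsto (fun n => C * r ^ 2 * d ^ n / (1 - d)) atTop (𝓝 0) := by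
      simpa using ((tendsto_pow_atTop_nhds_zero_of_lt_one hd0 hcq).const_mul
        (C * r ^ 2)).div_const (1 - d)
    rw [Metric.tendstoUniformlyOn_iff]
    intro ε hε
    filter_upwards [hbound.eventually_lt_const hε] with n hn x hx
    rw [dist_comm]
    refine (dist_le_of_le_geometric_of_tendsto d _ hcq (hstep x hx) (hψ x hx) n).trans_lt
      (lt_of_le_of_lt ?_ hn)
    have := sub_pos.2 hcq
    gcongr
    exact (mem_ball_zero_iff.1 hx).le
  · have hle : ∀ x ∈ ball (0 : E) r, ‖ψ x - x‖ ≤ C / (1 - d) * ‖x‖ ^ 2 := fun x hx => by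
      have := dist_le_of_le_geometric_of_tendsto₀ d _ hcq (hstep x hx) (hψ x hx)
      rw [dist_comm, dist_eq_norm] at this
      simp only [koenigsIterate, pow_zero, one_smul, Function.iterate_zero, id] at this
      exact this.trans_eq (by ring)
    have hψ0 : ψ 0 = 0 := by simpa using hle 0 (mem_ball_self hr)
    refine .of_isLittleO ?_
    have hO : (fun x => ψ x - x) =O[𝓝 0] fun x : E => ‖x‖ ^ 2 :=
      Asymptotics.IsBigO.of_bound (C / (1 - d)) <| by
        filter_upwards [ball_mem_nhds 0 hr] with x hx
        simpa using hle x hx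
    simpa [hψ0] using hO.trans_isLittleO (Asymptotics.isLittleO_norm_pow_id one_lt_two)

theorem hasFDerivAt_iterate (h : IsSmoothWithScalarPart c g U) {s : Set E} (hsU : s ⊆ U)
    (hs : MapsTo g s s) {x : E} (hx : x ∈ s) (n : ℕ) :
    HasFDerivAt g^[n] (fderiv ℝ g^[n] x) x := by
  refine DifferentiableAt.hasFDerivAt ?_
  induction n with
  | zero => exact differentiableAt_id
  | succ n ih =>
    rw [Function.iterate_succ']
    exact (h.differentiableAt (hsU (hs.iterate n hx))).comp x ih

theorem iterate_tangentExtension (h : IsSmoothWithScalarPart c g U) {s : Set E} (hsU : s ⊆ U)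
    (hs : MapsTo g s s) {x : E} (hx : x ∈ s) (v : E) (n : ℕ) :
    (tangentExtension g)^[n] (x, v) = (g^[n] x, fderiv ℝ g^[n] x v) := by
  induction n with
  | zero => simp
  | succ n ih =>
    have hcomp := ((h.differentiableAt (hsU (hs.iterate n hx))).hasFDerivAt.comp x
      (h.hasFDerivAt_iterate hsU hs hx n)).fderiv
    rw [← Function.iterate_succ'] at hcomp
    rw [Function.iterate_succ_apply', ih, hcomp, Function.iterate_succ_apply']
    rfl

/-- If the renormalized iterates of the tangent extension of `g` converge uniformly near `0` to
a `C^k` map, then those of `g` converge to a `C^(k+1)` map. -/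
theorem contDiffOn_succ_of_tangentExtension [FiniteDimensional ℝ E]
    (h : IsSmoothWithScalarPart c g U) {r : ℝ} (hrU : ball (0 : E) r ⊆ U)
    (hmaps : MapsTo g (ball 0 r) (ball 0 r)) {ψ : E → E}
    (hψ : TendstoUniformlyOn (koenigsIterate c g) ψ atTop (ball 0 r)) {ρ : ℝ} (hρ : 0 < ρ)
    {Ψ : E × E → E × E} {k : ℕ}
    (hΨ : TendstoUniformlyOn (koenigsIterate c (tangentExtension g)) Ψ atTop (ball 0 ρ))
    (hΨk : ContDiffOn ℝ k Ψ (ball 0 ρ)) :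
    ContDiffOn ℝ (k + 1 : ℕ) ψ (ball 0 (min r ρ)) := by
  set s : Set E := ball 0 (min r ρ)
  have hsr : s ⊆ ball 0 r := ball_subset_ball (min_le_left _ _)
  have hmem : ∀ x ∈ s, ∀ v ∈ ball (0 : E) ρ, (x, v) ∈ ball (0 : E × E) ρ := fun x hx v hv => by
    rw [mem_ball_zero_iff] at *
    exact max_lt (hx.trans_le (min_le_right _ _)) hv
  set L : ℕ → E → E →L[ℝ] E := fun n x => (c⁻¹) ^ n • fderiv ℝ g^[n] x with hL
  have hLT : ∀ n, ∀ x ∈ s, ∀ v,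
      L n x v = (koenigsIterate c (tangentExtension g) n (x, v)).2 := fun n x hx v => by
    simp [hL, koenigsIterate, h.iterate_tangentExtension hrU hmaps (hsr hx)]
  have hcauchy : UniformCauchySeqOn L atTop s := by
    rw [Metric.uniformCauchySeqOn_iff]
    intro ε hε
    obtain ⟨N, hN⟩ := Metric.uniformCauchySeqOn_iff.1 hΨ.uniformCauchySeqOn (ρ / 2 * (ε / 2))
      (by positivity)
    refine ⟨N, fun m hm n hn x hx => ?_⟩
    rw [dist_eq_norm]
    refine lt_of_le_of_lt (ContinuousLinearMap.opNorm_le_of_shell (c := (2 : ℝ)) hρ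
      (by positivity : 0 ≤ ε / 2) (by simp) fun v hv1 hv2 => ?_) (half_lt_self hε)
    have hd := hN m hm n hn (x, v) (hmem x hx v (by simpa using hv2))
    have hv : ρ / 2 ≤ ‖v‖ := by simpa using hv1
    rw [sub_apply, hLT m x hx, hLT n x hx, ← dist_eq_norm]
    calc _ ≤ ρ / 2 * (ε / 2) := (le_max_right _ _).trans hd.le
      _ ≤ ε / 2 * ‖v‖ := by nlinarith
  have hlim : ∀ x, ∃ A, x ∈ s → Tendsto (fun n => L n x) atTop (𝓝 A) := fun x => by
    by_cases hx : x ∈ s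
    · obtain ⟨A, hA⟩ := cauchySeq_tendsto_of_complete (hcauchy.cauchySeq hx)
      exact ⟨A, fun _ => hA⟩
    · exact ⟨0, fun h => absurd h hx⟩
  choose A hA using hlim
  have hderiv : ∀ x ∈ s, HasFDerivAt ψ (A x) x := fun x hx =>
    hasFDerivAt_of_tendstoUniformlyOn isOpen_ball
      (hcauchy.tendstoUniformlyOn_of_tendsto hA)
      (fun n y hy => (h.hasFDerivAt_iterate hrU hmaps (hsr hy) n).const_smul ((c⁻¹) ^ n))
      (fun y hy => hψ.tendsto_at (hsr hy)) hx
  have hAΨ : ∀ x ∈ s, ∀ v ∈ ball (0 : E) ρ, A x v = (Ψ (x, v)).2 := fun x hx v hv => by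
    have h1 : Tendsto (fun n => L n x v) atTop (𝓝 (A x v)) :=
      ((ContinuousLinearMap.apply ℝ E v).continuous.tendsto _).comp (hA x hx)
    have h2 := (continuous_snd.tendsto _).comp (hΨ.tendsto_at (hmem x hx v hv))
    exact tendsto_nhds_unique h1 (h2.congr fun n => (hLT n x hx v).symm)
  have hAk : ContDiffOn ℝ k A s := by
    refine contDiffOn_clm_apply.2 fun v => ?_
    obtain ⟨t, ht, htv⟩ : ∃ t : ℝ, t ≠ 0 ∧ t • v ∈ ball (0 : E) ρ := by
      have hcont : Tendsto (fun t : ℝ => t • v) (𝓝[≠] 0) (𝓝 0) := by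
        have : Continuous fun t : ℝ => t • v := by fun_prop
        simpa using (this.tendsto 0).mono_left nhdsWithin_le_nhds
      obtain ⟨t, h1, h2⟩ := ((hcont.eventually (ball_mem_nhds 0 hρ)).and
        self_mem_nhdsWithin).exists
      exact ⟨t, h2, h1⟩
    have h1 : ContDiffOn ℝ k (fun x => t⁻¹ • (Ψ (x, t • v)).2) s :=
      (contDiff_snd.comp_contDiffOn (hΨk.comp
        (contDiff_id.prodMk contDiff_const).contDiffOn fun x hx => hmem x hx _ htv)).const_smul _
    refine h1.congr fun x hx => ?_
    rw [← hAΨ x hx _ htv, map_smul, inv_smul_smul₀ ht]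
  rw [Nat.cast_succ, contDiffOn_succ_iff_fderiv_of_isOpen isOpen_ball]
  exact ⟨fun x hx => (hderiv x hx).differentiableAt.differentiableWithinAt, by simp,
    hAk.congr fun x hx => (hderiv x hx).fderiv⟩

/-- Near `0` the renormalized iterates converge uniformly to a `C^k` map; a priori the size of
the neighbourhood depends on `k`. -/
theorem exists_tendstoUniformlyOn_contDiffOn (hc0 : 0 < c) (hc1 : c < 1) (k : ℕ) :
    ∀ {E : Type u} [NormedAddCommGroup E] [NormedSpace ℝ E] [FiniteDimensional ℝ E]
      {g : E → E} {U : Set E}, IsSmoothWithScalarPart c g U →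
      ∃ r > 0, ∃ ψ : E → E, TendstoUniformlyOn (koenigsIterate c g) ψ atTop (ball 0 r) ∧
        ContDiffOn ℝ k ψ (ball 0 r) := by
  induction k with
  | zero =>
    intro E _ _ _ g U h
    have := FiniteDimensional.complete ℝ E
    obtain ⟨r, hr, hrU, hmaps, -, ψ, hψ, -⟩ := h.exists_tendstoUniformlyOn hc0 hc1
    refine ⟨r, hr, ψ, hψ, ?_⟩
    rw [Nat.cast_zero, contDiffOn_zero]
    exact hψ.continuousOn (.of_forall fun n x hx =>
      ((h.hasFDerivAt_iterate hrU hmaps hx n).continuousAt.const_smul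
        ((c⁻¹) ^ n)).continuousWithinAt)
  | succ k ih =>
    intro E _ _ _ g U h
    have := FiniteDimensional.complete ℝ E
    obtain ⟨r, hr, hrU, hmaps, -, ψ, hψ, -⟩ := h.exists_tendstoUniformlyOn hc0 hc1
    obtain ⟨ρ, hρ, Ψ, hΨ, hΨk⟩ := ih h.tangent
    exact ⟨min r ρ, lt_min hr hρ, ψ, hψ.mono (ball_subset_ball (min_le_left _ _)),
      h.contDiffOn_succ_of_tangentExtension hrU hmaps hψ hρ hΨ hΨk⟩

/-- Sternberg linearization of a smooth contraction of a finite-dimensional space whose linear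
part is scalar. -/
theorem exists_linearization [FiniteDimensional ℝ E] (h : IsSmoothWithScalarPart c g U)
    (hc0 : 0 < c) (hc1 : c < 1) :
    ∃ r > 0, ∃ ψ : E → E, ContDiffOn ℝ ∞ ψ (ball 0 r) ∧ ψ 0 = 0 ∧
      HasFDerivAt ψ (ContinuousLinearMap.id ℝ E) 0 ∧
      ∀ x ∈ ball (0 : E) r, ψ (g x) = c • ψ x := by
  have := FiniteDimensional.complete ℝ E
  obtain ⟨r, hr, hrU, hmaps, hzero, ψ, hψ, hψ'⟩ := h.exists_tendstoUniformlyOn hc0 hc1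
  have hfun : ∀ x ∈ ball (0 : E) r, ψ (g x) = c • ψ x := fun x hx => by
    have h1 := ((hψ.tendsto_at hx).comp (tendsto_add_atTop_nat 1)).const_smul c
    refine tendsto_nhds_unique (hψ.tendsto_at (hmaps hx)) (h1.congr fun n => ?_)
    simp only [Function.comp_apply, koenigsIterate, Function.iterate_succ_apply, smul_smul]
    rw [pow_succ, mul_comm c, inv_mul_cancel_right₀ hc0.ne']
  have hiter : ∀ n, ∀ x ∈ ball (0 : E) r, ψ x = (c⁻¹) ^ n • ψ (g^[n] x) := fun n => by
    induction n with
    | zero => simp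
    | succ n ih =>
      intro x hx
      rw [Function.iterate_succ_apply', hfun _ (hmaps.iterate n hx), smul_smul, pow_succ,
        inv_mul_cancel_right₀ hc0.ne', ← ih x hx]
  have hψ0 : ψ 0 = 0 := by
    have h0 := hfun 0 (mem_ball_self hr)
    rw [h.map_zero] at h0
    have h1 : (1 - c) • ψ 0 = 0 := by rw [sub_smul, one_smul, ← h0, sub_self]
    exact (smul_eq_zero.1 h1).resolve_left (sub_pos.2 hc1).ne'
  refine ⟨r, hr, ψ, contDiffOn_infty.2 fun k x hx => ?_, hψ0, hψ', hfun⟩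
  obtain ⟨ρ, hρ, ψ', hψ', hk⟩ := exists_tendstoUniformlyOn_contDiffOn hc0 hc1 k h
  have hk0 : ContDiffOn ℝ k ψ (ball 0 (min r ρ)) :=
    (hk.mono (ball_subset_ball (min_le_right _ _))).congr fun y hy => tendsto_nhds_unique
      (hψ.tendsto_at (ball_subset_ball (min_le_left _ _) hy))
      (hψ'.tendsto_at (ball_subset_ball (min_le_right _ _) hy))
  obtain ⟨n, hn⟩ := ((hzero x hx).eventually (ball_mem_nhds 0 (lt_min hr hρ))).exists
  have hsmooth : ContDiffOn ℝ k g^[n] (ball 0 r) := by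
    clear hn
    induction n with
    | zero => exact contDiffOn_id
    | succ n ih =>
      rw [Function.iterate_succ']
      exact ((h.contDiffOn.of_le (by exact_mod_cast le_top)).mono hrU).comp ih
        (hmaps.iterate n)
  have hat : ContDiffAt ℝ k (fun y => (c⁻¹) ^ n • ψ (g^[n] y)) x :=
    ((hk0.contDiffAt (isOpen_ball.mem_nhds hn)).comp x
      (hsmooth.contDiffAt (isOpen_ball.mem_nhds hx))).const_smul _
  refine (hat.congr_of_eventuallyEq ?_).contDiffWithinAt
  filter_upwards [isOpen_ball.mem_nhds hx] with y hy using hiter n y hy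

end IsSmoothWithScalarPart

/-- The smooth inverse function theorem, in terms of `IsSmoothDiffeoOn`. -/
theorem exists_isSmoothDiffeoOn {ψ : EuclideanSpace ℝ (Fin 2) → EuclideanSpace ℝ (Fin 2)}
    {W : Set (EuclideanSpace ℝ (Fin 2))} (hW : IsOpen W) (hψ : ContDiffOn ℝ ∞ ψ W)
    {a : EuclideanSpace ℝ (Fin 2)} (ha : a ∈ W)
    {f' : EuclideanSpace ℝ (Fin 2) ≃L[ℝ] EuclideanSpace ℝ (Fin 2)}
    (hf' : HasFDerivAt ψ (f' : EuclideanSpace ℝ (Fin 2) →L[ℝ] EuclideanSpace ℝ (Fin 2)) a) :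
    ∃ V, a ∈ V ∧ IsSmoothDiffeoOn ψ V := by
  have hat : ∀ x ∈ W, ContDiffAt ℝ ∞ ψ x := fun x hx => hψ.contDiffAt (hW.mem_nhds hx)
  set e := (hat a ha).toOpenPartialHomeomorph ψ hf' (by simp)
  have hcont : ContinuousOn (fderiv ℝ ψ) W := hψ.continuousOn_fderiv_of_isOpen hW (by simp)
  set V := e.source ∩ (W ∩ fderiv ℝ ψ ⁻¹' range
    ((↑) : (EuclideanSpace ℝ (Fin 2) ≃L[ℝ] EuclideanSpace ℝ (Fin 2)) → _))
  have hVopen : IsOpen V := e.open_source.inter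
    (hcont.isOpen_inter_preimage hW ContinuousLinearEquiv.isOpen)
  have hVsub : V ⊆ e.source := inter_subset_left
  refine ⟨V, ⟨(hat a ha).mem_toOpenPartialHomeomorph_source hf' (by simp), ha, f',
    hf'.fderiv.symm⟩, hVopen, hψ.mono fun x hx => hx.2.1, e.injOn.mono hVsub,
    e.isOpen_image_of_subset_source hVopen hVsub, e.symm, ?_, fun x hx => e.left_inv (hVsub hx)⟩
  rintro _ ⟨x, hx, rfl⟩
  obtain ⟨B, hB⟩ := hx.2.2
  have hx' : e.symm (ψ x) = x := e.left_inv (hVsub hx)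
  refine (e.contDiffAt_symm (f₀' := B) (e.map_source (hVsub hx)) ?_ ?_).contDiffWithinAt
  · change HasFDerivAt ψ _ (e.symm (ψ x))
    rw [hx', hB]
    exact ((hat x hx.2.1).differentiableAt (by simp)).hasFDerivAt
  · change ContDiffAt ℝ ∞ ψ (e.symm (ψ x))
    rw [hx']
    exact hat x hx.2.1

/-- Let `λ > 1` and let `φ` be a `C^∞` diffeomorphism from a neighbourhood of `0 ∈ ℝ²` onto an
open set with `φ 0 = 0` and `D₀φ = Id`.  Then there are a `C^∞` diffeomorphism `ψ` of a
neighbourhood `V` of `0` onto an open set with `ψ 0 = 0` and `D₀ψ = Id`, and a neighbourhood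
`U'` of `0` on which `ψ (φ x) = λ⁻¹ • ψ (λ • x)`; i.e. the germ of `φ` at `0` is the commutator
`[ψ⁻¹, A_λ⁻¹]` of the germs of `ψ⁻¹` and of the inverse of the scalar map `A_λ : x ↦ λ • x`. -/
theorem germ_with_trivial_linear_part_is_commutator (lam : ℝ) (hlam : 1 < lam)
    (U : Set (EuclideanSpace ℝ (Fin 2)))
    (φ : EuclideanSpace ℝ (Fin 2) → EuclideanSpace ℝ (Fin 2))
    (h0U : (0 : EuclideanSpace ℝ (Fin 2)) ∈ U)
    (hφ : IsSmoothDiffeoOn φ U) (hφ0 : φ 0 = 0)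
    (hD : fderiv ℝ φ 0 = ContinuousLinearMap.id ℝ (EuclideanSpace ℝ (Fin 2))) :
    ∃ (V U' : Set (EuclideanSpace ℝ (Fin 2)))
      (ψ : EuclideanSpace ℝ (Fin 2) → EuclideanSpace ℝ (Fin 2)),
      (0 : EuclideanSpace ℝ (Fin 2)) ∈ V ∧ IsSmoothDiffeoOn ψ V ∧ ψ 0 = 0 ∧
      fderiv ℝ ψ 0 = ContinuousLinearMap.id ℝ (EuclideanSpace ℝ (Fin 2)) ∧
      IsOpen U' ∧ (0 : EuclideanSpace ℝ (Fin 2)) ∈ U' ∧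
      ∀ x ∈ U', ψ (φ x) = lam⁻¹ • ψ (lam • x) := by
  obtain ⟨hUo, hφs, -⟩ := hφ
  have hlam0 : 0 < lam := one_pos.trans hlam
  have hφ' : HasFDerivAt φ (ContinuousLinearMap.id ℝ (EuclideanSpace ℝ (Fin 2)))
      (lam⁻¹ • (0 : EuclideanSpace ℝ (Fin 2))) := by
    rw [smul_zero, ← hD]
    exact ((hφs.contDiffAt (hUo.mem_nhds h0U)).differentiableAt (by simp)).hasFDerivAt
  have hg : IsSmoothWithScalarPart lam⁻¹ (fun x => φ (lam⁻¹ • x)) ((lam⁻¹ • ·) ⁻¹' U) :=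
    { isOpen := hUo.preimage (continuous_const_smul _)
      zero_mem := by simpa using h0U
      contDiffOn := hφs.comp (contDiff_id.const_smul lam⁻¹).contDiffOn fun x hx => hx
      map_zero := by simpa using hφ0
      hasFDerivAt_zero :=
        hφ'.comp (0 : EuclideanSpace ℝ (Fin 2)) ((hasFDerivAt_id _).const_smul lam⁻¹) }
  obtain ⟨r, hr, ψ, hψ, hψ0, hψ', hconj⟩ :=
    hg.exists_linearization (inv_pos.2 hlam0) (inv_lt_one_of_one_lt₀ hlam)
  obtain ⟨V, h0V, hV⟩ := exists_isSmoothDiffeoOn isOpen_ball hψ (mem_ball_self hr)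
    (f' := ContinuousLinearEquiv.refl ℝ _) hψ'
  refine ⟨V, (lam • ·) ⁻¹' ball 0 r, ψ, h0V, hV, hψ0, hψ'.fderiv,
    isOpen_ball.preimage (continuous_const_smul _), by simpa using hr, fun x hx => ?_⟩
  simpa [smul_smul, inv_mul_cancel₀ hlam0.ne'] using hconj (lam • x) hx
end

section
/- Let φ be a C^∞ diffeomorphism from an open neighbourhood U of the origin in ℝ² onto an open subset of ℝ², with φ(0) = 0 and det(D₀φ) > 0. Then there exists a C^∞ diffeomorphism Φ of ℝ² such that Φ(0) = 0, Φ agrees with the identity outside some compact subset of ℝ², and Φ agrees with φ on some open neighbourhood of 0. (Every germ at the origin of an orientation-preserving diffeomorphism fixing 0 is the germ of a compactly supported diffeomorphism of the plane fixing 0.) -/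
open scoped ContDiff

open Filter Topology Metric Set
open scoped NNReal

section Diffeo

variable {E : Type*} [NormedAddCommGroup E] [NormedSpace ℝ E]

variable (E) in
/-- The group of compactly supported `C^∞` diffeomorphisms fixing the origin. -/
def compactDiffeo : Subgroup (Equiv.Perm E) where
  carrier := {Φ | ContDiff ℝ ∞ Φ ∧ ContDiff ℝ ∞ Φ.symm ∧ Φ 0 = 0 ∧
    HasCompactSupport (fun x => Φ x - x)}
  one_mem' := by
    refine ⟨contDiff_id, contDiff_id, rfl, ?_⟩
    simpa using! HasCompactSupport.zero (α := E) (β := E)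
  mul_mem' := by
    rintro Φ Ψ ⟨hΦ, hΦ', hΦ0, hΦc⟩ ⟨hΨ, hΨ', hΨ0, hΨc⟩
    refine ⟨hΦ.comp hΨ, hΨ'.comp hΦ', by simp [hΦ0, hΨ0], ?_⟩
    refine HasCompactSupport.of_support_subset_isCompact (hΦc.isCompact.union hΨc.isCompact) ?_
    intro x hx
    by_contra h
    simp only [mem_union, not_or] at h
    have h₁ := image_eq_zero_of_notMem_tsupport h.1
    have h₂ := image_eq_zero_of_notMem_tsupport h.2
    simp only [sub_eq_zero] at h₁ h₂
    exact hx (by simp [h₁, h₂])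
  inv_mem' := by
    rintro Φ ⟨hΦ, hΦ', hΦ0, hΦc⟩
    refine ⟨hΦ', hΦ, (Equiv.symm_apply_eq Φ).2 hΦ0.symm, ?_⟩
    refine hΦc.mono fun x hx h => hx ?_
    simp only [sub_eq_zero] at h ⊢
    exact (Equiv.symm_apply_eq Φ).2 h.symm

theorem mem_compactDiffeo {Φ : Equiv.Perm E} :
    Φ ∈ compactDiffeo E ↔ ContDiff ℝ ∞ Φ ∧ ContDiff ℝ ∞ Φ.symm ∧ Φ 0 = 0 ∧
      HasCompactSupport (fun x => Φ x - x) :=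
  Iff.rfl

/-- The linear automorphisms whose germ at `0` extends to a compactly supported diffeomorphism. -/
def extendableUnits (E : Type*) [NormedAddCommGroup E] [NormedSpace ℝ E] :
    Subgroup (E →L[ℝ] E)ˣ where
  carrier := {A | ∃ Φ ∈ compactDiffeo E, ∀ᶠ x in 𝓝 0, Φ x = (A : E →L[ℝ] E) x}
  one_mem' := ⟨1, one_mem _, Eventually.of_forall fun _ => rfl⟩
  mul_mem' := by
    rintro A B ⟨Φ, hΦ, hΦA⟩ ⟨Ψ, hΨ, hΨB⟩
    refine ⟨Φ * Ψ, mul_mem hΦ hΨ, ?_⟩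
    have hB : Tendsto (B : E →L[ℝ] E) (𝓝 0) (𝓝 0) :=
      (B : E →L[ℝ] E).continuous.tendsto' _ _ (map_zero _)
    filter_upwards [hΨB, hB.eventually hΦA] with x h₁ h₂
    simp [h₁, h₂]
  inv_mem' := by
    rintro A ⟨Φ, hΦ, hΦA⟩
    refine ⟨Φ⁻¹, inv_mem hΦ, ?_⟩
    have hA : Tendsto ((A⁻¹ : (E →L[ℝ] E)ˣ) : E →L[ℝ] E) (𝓝 0) (𝓝 0) :=
      ((A⁻¹ : (E →L[ℝ] E)ˣ) : E →L[ℝ] E).continuous.tendsto' _ _ (map_zero _)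
    filter_upwards [hA.eventually hΦA] with x h
    refine (Equiv.symm_apply_eq Φ).2 ?_
    rw [h, ← mul_apply_eq_comp, A.mul_inv, one_apply_eq_self]

/-- A `C^∞` contractive perturbation of the identity is a diffeomorphism. -/
theorem exists_perm_of_lipschitzWith [CompleteSpace E] {f : E → E} {c : ℝ≥0} (hc : c < 1)
    (hf : ContDiff ℝ ∞ f) (hlip : LipschitzWith c f) :
    ∃ Φ : Equiv.Perm E, ContDiff ℝ ∞ Φ ∧ ContDiff ℝ ∞ Φ.symm ∧ ∀ x, Φ x = x + f x := by
  have happ : ApproximatesLinearOn (fun x => x + f x)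
      ((ContinuousLinearEquiv.refl ℝ E : E ≃L[ℝ] E) : E →L[ℝ] E) univ c := by
    intro x _ y _
    have : x + f x - (y + f y) - (x - y) = f x - f y := by abel
    simpa [this] using hlip.norm_sub_le x y
  have hc' : Subsingleton E ∨
      c < ‖((ContinuousLinearEquiv.refl ℝ E).symm : E →L[ℝ] E)‖₊⁻¹ := by
    rcases subsingleton_or_nontrivial E with h | h
    · exact Or.inl h
    · right
      have : ‖((ContinuousLinearEquiv.refl ℝ E).symm : E →L[ℝ] E)‖₊ = 1 := by
        simp
      simpa [this] using hc
  let Φ : E ≃ₜ E := happ.toHomeomorph _ hc'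
  have hΦ : ∀ x, Φ x = x + f x := fun _ => rfl
  have hsmooth : ContDiff ℝ ∞ Φ := contDiff_id.add hf
  have hnorm (a : E) : ‖-fderiv ℝ f a‖ < 1 := by
    rw [norm_neg]
    exact (norm_fderiv_le_of_lipschitz ℝ hlip).trans_lt (by exact_mod_cast hc)
  refine ⟨Φ.toEquiv, hsmooth, Φ.contDiff_symm
    (f₀' := fun a => ContinuousLinearEquiv.ofUnit (Units.oneSub _ (hnorm a))) ?_ hsmooth, hΦ⟩
  intro a
  have h := (hasFDerivAt_id a).add (hf.differentiable (by simp) a).hasFDerivAt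
  have hD : (ContinuousLinearEquiv.ofUnit (Units.oneSub _ (hnorm a)) : E →L[ℝ] E) =
      ContinuousLinearMap.id ℝ E + fderiv ℝ f a := by
    change (1 - -fderiv ℝ f a : E →L[ℝ] E) = _
    rw [sub_neg_eq_add]
    rfl
  rw [hD]
  exact h

/-- Multiplying by a cutoff function at scale `r` keeps the Lipschitz constant under control
independently of `r`. -/
theorem lipschitzWith_cutoff_smul {ρ : E → ℝ} {C ε : ℝ≥0} (hρ : LipschitzWith C ρ)
    (hρ1 : ∀ x, |ρ x| ≤ 1) (hρ0 : ∀ x, 2 ≤ ‖x‖ → ρ x = 0) {g : E → E} {r : ℝ} (hr : 0 < r)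
    (hg0 : g 0 = 0) (hg : LipschitzOnWith ε g (ball 0 (3 * r))) :
    LipschitzWith ((2 * C + 1) * ε) fun x => ρ (r⁻¹ • x) • g x := by
  have hzero (x : E) (hx : 2 * r ≤ ‖x‖) : ρ (r⁻¹ • x) = 0 := by
    apply hρ0
    rw [norm_smul, norm_inv, Real.norm_of_nonneg hr.le, inv_mul_eq_div, le_div_iff₀ hr]
    exact hx
  have hone_side (x y : E) (hx : ‖x‖ < 2 * r) :
      ‖ρ (r⁻¹ • x) • g x - ρ (r⁻¹ • y) • g y‖ ≤ ((2 * C + 1) * ε : ℝ≥0) * ‖x - y‖ := by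
    have hxb : x ∈ ball (0 : E) (3 * r) := by rw [mem_ball_zero_iff]; linarith
    have hgx : ‖g x‖ ≤ ε * (2 * r) := by
      have h := hg.norm_sub_le hxb (mem_ball_self (by linarith))
      rw [hg0, sub_zero, sub_zero] at h
      exact h.trans (by gcongr)
    have h₁ : ‖(ρ (r⁻¹ • x) - ρ (r⁻¹ • y)) • g x‖ ≤ 2 * C * ε * ‖x - y‖ := by
      have h := hρ.norm_sub_le (r⁻¹ • x) (r⁻¹ • y)
      rw [← smul_sub, norm_smul, norm_inv, Real.norm_of_nonneg hr.le] at h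
      rw [norm_smul]
      calc _ ≤ C * (r⁻¹ * ‖x - y‖) * (ε * (2 * r)) := by gcongr
        _ = _ := by field_simp
    have h₂ : ‖ρ (r⁻¹ • y) • (g x - g y)‖ ≤ ε * ‖x - y‖ := by
      rcases lt_or_ge ‖y‖ (2 * r) with hy | hy
      · have hyb : y ∈ ball (0 : E) (3 * r) := by rw [mem_ball_zero_iff]; linarith
        rw [norm_smul]
        exact (mul_le_of_le_one_left (norm_nonneg _) (hρ1 _)).trans (hg.norm_sub_le hxb hyb)
      · rw [hzero y hy, zero_smul, norm_zero]
        positivity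
    have hsplit : ρ (r⁻¹ • x) • g x - ρ (r⁻¹ • y) • g y =
        (ρ (r⁻¹ • x) - ρ (r⁻¹ • y)) • g x + ρ (r⁻¹ • y) • (g x - g y) := by
      rw [sub_smul, smul_sub]; abel
    rw [hsplit]
    refine (norm_add_le _ _).trans ((add_le_add h₁ h₂).trans_eq ?_)
    push_cast
    ring
  refine LipschitzWith.of_dist_le_mul fun x y => ?_
  rw [dist_eq_norm, dist_eq_norm]
  rcases lt_or_ge ‖x‖ (2 * r) with hx | hx
  · exact hone_side x y hx
  rcases lt_or_ge ‖y‖ (2 * r) with hy | hy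
  · rw [norm_sub_rev, norm_sub_rev x]
    exact hone_side y x hy
  · rw [hzero x hx, hzero y hy, zero_smul, zero_smul, sub_zero, norm_zero]
    positivity

variable [FiniteDimensional ℝ E]

variable (E) in
/-- Germs at `0` sufficiently `C^1`-close to the identity extend to compactly supported
diffeomorphisms. -/
theorem exists_compactDiffeo_of_lipschitzOnWith :
    ∃ ε : ℝ≥0, 0 < ε ∧ ∀ (g : E → E) (r : ℝ), 0 < r → g 0 = 0 →
      ContDiffOn ℝ ∞ g (ball 0 (3 * r)) → LipschitzOnWith ε g (ball 0 (3 * r)) →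
      ∃ Φ ∈ compactDiffeo E, ∀ᶠ x in 𝓝 0, Φ x = x + g x := by
  let ρ : ContDiffBump (0 : E) := ⟨1, 2, one_pos, one_lt_two⟩
  have hρs : ContDiff ℝ ∞ ρ := ρ.contDiff
  obtain ⟨C, hC⟩ := hρs.lipschitzWith_of_hasCompactSupport ρ.hasCompactSupport (by simp)
  have hpos : 0 < 2 * C + 1 := by positivity
  refine ⟨(2 * C + 1)⁻¹ * 2⁻¹, by positivity, fun g r hr hg0 hgs hg => ?_⟩
  have hρ0 : ∀ x, 2 ≤ ‖x‖ → ρ x = 0 := fun x hx => ρ.zero_of_le_dist (by simpa [ρ] using hx)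
  have hlip := lipschitzWith_cutoff_smul hC
    (fun x => by rw [abs_of_nonneg ρ.nonneg]; exact ρ.le_one) hρ0 hr hg0 hg
  have hzero (x : E) (hx : 2 * r ≤ ‖x‖) : ρ (r⁻¹ • x) = 0 := by
    apply hρ0
    rw [norm_smul, norm_inv, Real.norm_of_nonneg hr.le, inv_mul_eq_div, le_div_iff₀ hr]
    exact hx
  have hsmooth : ContDiff ℝ ∞ fun x => ρ (r⁻¹ • x) • g x := by
    refine contDiff_iff_contDiffAt.2 fun x => ?_
    rcases lt_or_ge ‖x‖ (3 * r) with hx | hx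
    · have hgx : ContDiffAt ℝ ∞ g x :=
        hgs.contDiffAt (isOpen_ball.mem_nhds (mem_ball_zero_iff.2 hx))
      exact (hρs.comp (contDiff_const_smul r⁻¹)).contDiffAt.smul hgx
    · have hev : ∀ᶠ y in 𝓝 x, 2 * r < ‖y‖ :=
        continuous_norm.continuousAt.eventually_const_lt (by linarith)
      refine contDiffAt_const (c := (0 : E)) |>.congr_of_eventuallyEq ?_
      filter_upwards [hev] with y hy
      rw [hzero y hy.le, zero_smul]
  obtain ⟨Φ, hΦ, hΦ', hΦe⟩ := exists_perm_of_lipschitzWith (by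
    rw [← mul_assoc, mul_inv_cancel₀ hpos.ne', one_mul]
    exact inv_lt_one_of_one_lt₀ one_lt_two) hsmooth hlip
  refine ⟨Φ, ⟨hΦ, hΦ', by simp [hΦe, hg0], ?_⟩, ?_⟩
  · refine HasCompactSupport.of_support_subset_isCompact (isCompact_closedBall 0 (2 * r)) ?_
    intro x hx
    rw [mem_closedBall_zero_iff]
    by_contra! h
    exact hx (by simp [hΦe, hzero x h.le])
  · filter_upwards [ball_mem_nhds (0 : E) hr] with x hx
    rw [hΦe, ρ.one_of_mem_closedBall, one_smul]
    rw [mem_ball_zero_iff] at hx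
    rw [mem_closedBall_zero_iff, norm_smul, norm_inv, Real.norm_of_nonneg hr.le,
      inv_mul_eq_div, div_le_one hr]
    exact hx.le

/-- A germ tangent to the identity extends to a compactly supported diffeomorphism. -/
theorem exists_compactDiffeo_of_fderiv_eq_id {ψ : E → E} {U : Set E} (hU : IsOpen U)
    (h0U : (0 : E) ∈ U) (hψ : ContDiffOn ℝ ∞ ψ U) (hψ0 : ψ 0 = 0) (hψ' : HasFDerivAt ψ (ContinuousLinearMap.id ℝ E) 0) :
    ∃ Φ ∈ compactDiffeo E, ∀ᶠ x in 𝓝 0, Φ x = ψ x := by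
  obtain ⟨ε, hε, H⟩ := exists_compactDiffeo_of_lipschitzOnWith E
  have hstrict : HasStrictFDerivAt (fun x => ψ x - x) (0 : E →L[ℝ] E) 0 := by
    simpa using! ((hψ.contDiffAt (hU.mem_nhds h0U)).hasStrictFDerivAt' hψ' (by simp)).sub
      (hasStrictFDerivAt_id (0 : E))
  obtain ⟨s, hs, hlip⟩ := hstrict.exists_lipschitzOnWith_of_nnnorm_lt ε (by simpa using hε)
  obtain ⟨R, hR, hball⟩ := Metric.mem_nhds_iff.1 (inter_mem hs (hU.mem_nhds h0U))
  have hR3 : 3 * (R / 3) = R := by ring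
  obtain ⟨Φ, hΦ, h⟩ := H (fun x => ψ x - x) (R / 3) (by positivity) (by simp [hψ0])
    ((hψ.mono fun x hx => (hball (hR3 ▸ hx)).2).sub contDiffOn_id)
    (hlip.mono fun x hx => (hball (hR3 ▸ hx)).1)
  exact ⟨Φ, hΦ, h.mono fun x hx => by simpa using hx⟩

theorem isOpen_extendableUnits : IsOpen (extendableUnits E : Set (E →L[ℝ] E)ˣ) := by
  have : CompleteSpace E := FiniteDimensional.complete ℝ E
  obtain ⟨ε, hε, H⟩ := exists_compactDiffeo_of_lipschitzOnWith E
  refine (extendableUnits E).isOpen_of_mem_nhds (g := 1) ?_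
  have hcont : ContinuousAt (fun A : (E →L[ℝ] E)ˣ => ‖(A : E →L[ℝ] E) - 1‖₊) 1 :=
    (Units.continuous_val.sub continuous_const).nnnorm.continuousAt
  filter_upwards [hcont.eventually_lt_const (u := ε) (by simpa using hε)] with A hA
  obtain ⟨Φ, hΦ, h⟩ := H ((A : E →L[ℝ] E) - 1 : E →L[ℝ] E) 1 one_pos (map_zero _)
    (ContinuousLinearMap.contDiff _).contDiffOn
    ((ContinuousLinearMap.lipschitz _).weaken hA.le).lipschitzOnWith
  exact ⟨Φ, hΦ, h.mono fun x hx => by simpa using hx⟩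

/-- A linear automorphism joined to the identity by a segment of automorphisms is extendable. -/
theorem mem_extendableUnits_of_isUnit_segment (A : (E →L[ℝ] E)ˣ)
    (hA : ∀ t ∈ Icc (0 : ℝ) 1, IsUnit ((1 - t) • (1 : E →L[ℝ] E) + t • (A : E →L[ℝ] E))) :
    A ∈ extendableUnits E := by
  have : CompleteSpace E := FiniteDimensional.complete ℝ E
  choose γ hγ using fun t : Icc (0 : ℝ) 1 => hA t t.2
  have hcont : Continuous γ := by
    rw [Units.isOpenEmbedding_val.isInducing.continuous_iff]
    have : Units.val ∘ γ = fun t : Icc (0 : ℝ) 1 =>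
        (1 - (t : ℝ)) • (1 : E →L[ℝ] E) + (t : ℝ) • (A : E →L[ℝ] E) := funext hγ
    rw [this]
    fun_prop
  have hclopen : IsClopen (γ ⁻¹' (extendableUnits E : Set (E →L[ℝ] E)ˣ)) :=
    IsClopen.preimage ⟨Subgroup.isClosed_of_isOpen _ isOpen_extendableUnits,
      isOpen_extendableUnits⟩ hcont
  have h0 : γ 0 = 1 := Units.ext (by simp [hγ])
  have h1 : γ 1 = A := Units.ext (by simp [hγ])
  have huniv := hclopen.eq_univ ⟨0, by simp [h0, one_mem]⟩
  have : γ 1 ∈ extendableUnits E := by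
    have : (1 : Icc (0 : ℝ) 1) ∈ γ ⁻¹' (extendableUnits E : Set (E →L[ℝ] E)ˣ) := by
      rw [huniv]; trivial
    exact this
  rwa [h1] at this

end Diffeo

section Plane

/-- Invertible matrices, acting as continuous linear automorphisms of the Euclidean plane. -/
noncomputable def planeUnits :
    (Matrix (Fin 2) (Fin 2) ℝ)ˣ →*
      (EuclideanSpace ℝ (Fin 2) →L[ℝ] EuclideanSpace ℝ (Fin 2))ˣ :=
  Units.map (Matrix.toEuclideanCLM (n := Fin 2) (𝕜 := ℝ)).toMulEquiv.toMonoidHom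

theorem planeUnits_mem_of_trace_nonneg (M : (Matrix (Fin 2) (Fin 2) ℝ)ˣ)
    (hdet : 0 < (M : Matrix (Fin 2) (Fin 2) ℝ).det)
    (htr : 0 ≤ (M : Matrix (Fin 2) (Fin 2) ℝ).trace) :
    planeUnits M ∈ extendableUnits (EuclideanSpace ℝ (Fin 2)) := by
  refine mem_extendableUnits_of_isUnit_segment _ fun t ht => ?_
  have hunit : IsUnit ((1 - t) • (1 : Matrix (Fin 2) (Fin 2) ℝ) + t • M.val) := by
    rw [Matrix.isUnit_iff_isUnit_det, isUnit_iff_ne_zero]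
    have hexp : ((1 - t) • (1 : Matrix (Fin 2) (Fin 2) ℝ) + t • M.val).det =
        (1 - t) ^ 2 + t * (1 - t) * M.val.trace + t ^ 2 * M.val.det := by
      simp [Matrix.det_fin_two, Matrix.trace_fin_two]
      ring
    rw [hexp]
    have h₁ : 0 ≤ t * (1 - t) * M.val.trace :=
      mul_nonneg (mul_nonneg ht.1 (by linarith [ht.2])) htr
    rcases ht.1.eq_or_lt with rfl | ht0
    · simp
    · positivity
  convert hunit.map (Matrix.toEuclideanCLM (n := Fin 2) (𝕜 := ℝ)) using 1
  rw [map_add, map_smul, map_smul, map_one]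
  rfl

theorem planeUnits_mem_of_det_pos (M : (Matrix (Fin 2) (Fin 2) ℝ)ˣ)
    (hdet : 0 < (M : Matrix (Fin 2) (Fin 2) ℝ).det) :
    planeUnits M ∈ extendableUnits (EuclideanSpace ℝ (Fin 2)) := by
  rcases le_or_gt 0 M.val.trace with htr | htr
  · exact planeUnits_mem_of_trace_nonneg M hdet htr
  let J : (Matrix (Fin 2) (Fin 2) ℝ)ˣ :=
    ⟨!![0, -1; 1, 0], !![0, 1; -1, 0], by simp [Matrix.one_fin_two],
      by simp [Matrix.one_fin_two]⟩
  have hJ : planeUnits J ∈ extendableUnits (EuclideanSpace ℝ (Fin 2)) :=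
    planeUnits_mem_of_trace_nonneg J (by simp [J, Matrix.det_fin_two])
      (by simp [J, Matrix.trace_fin_two])
  have hM : M = J * J * -M := by
    have : J * J = -1 := Units.ext (by simp [J, Matrix.one_fin_two])
    simp [this]
  rw [hM, map_mul, map_mul]
  refine mul_mem (mul_mem hJ hJ) (planeUnits_mem_of_trace_nonneg _ ?_ ?_)
  · simpa [Matrix.det_neg] using hdet
  · simpa using htr.le

theorem mem_extendableUnits_of_det_pos
    (A : (EuclideanSpace ℝ (Fin 2) →L[ℝ] EuclideanSpace ℝ (Fin 2))ˣ)
    (hdet : 0 < A.val.det) : A ∈ extendableUnits (EuclideanSpace ℝ (Fin 2)) := by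
  let e := Matrix.toEuclideanCLM (n := Fin 2) (𝕜 := ℝ)
  let M : (Matrix (Fin 2) (Fin 2) ℝ)ˣ := Units.map e.symm.toMulEquiv.toMonoidHom A
  have hMA : e M.val = A.val := e.apply_symm_apply _
  have hA : planeUnits M = A := Units.ext hMA
  have hM : M.val.det = A.val.det := by
    rw [← hMA]
    exact (LinearMap.det_toLin (EuclideanSpace.basisFun (Fin 2) ℝ).toBasis M.val).symm
  rw [← hA]
  exact planeUnits_mem_of_det_pos M (hM ▸ hdet)

end Plane

/-- Every germ at the origin of an orientation-preserving `C^∞` diffeomorphism fixing `0` is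
the germ of a compactly supported `C^∞` diffeomorphism of the plane fixing `0`: if `φ` is a
`C^∞` diffeomorphism of a neighbourhood `U` of `0 ∈ ℝ²` onto an open set, with `φ 0 = 0` and
`det (D₀φ) > 0`, then there is a `C^∞` diffeomorphism `Φ` of `ℝ²` with `Φ 0 = 0`, agreeing
with the identity outside a compact set, and agreeing with `φ` near `0`. -/
theorem germ_extends_to_compactly_supported_diffeo
    (U : Set (EuclideanSpace ℝ (Fin 2)))
    (φ : EuclideanSpace ℝ (Fin 2) → EuclideanSpace ℝ (Fin 2))
    (h0U : (0 : EuclideanSpace ℝ (Fin 2)) ∈ U)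
    (hφ : IsSmoothDiffeoOn φ U) (hφ0 : φ 0 = 0)
    (hdet : 0 < (fderiv ℝ φ 0).det) :
    ∃ Φ : EuclideanSpace ℝ (Fin 2) ≃ EuclideanSpace ℝ (Fin 2),
      ContDiff ℝ ∞ Φ ∧ ContDiff ℝ ∞ Φ.symm ∧ Φ 0 = 0 ∧
      HasCompactSupport (fun x => Φ x - x) ∧
      ∃ V : Set (EuclideanSpace ℝ (Fin 2)),
        IsOpen V ∧ (0 : EuclideanSpace ℝ (Fin 2)) ∈ V ∧ ∀ x ∈ V, Φ x = φ x := by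
  obtain ⟨hU, hφs, -⟩ := hφ
  have hφ₀ : ContDiffAt ℝ ∞ φ 0 := hφs.contDiffAt (hU.mem_nhds h0U)
  have hφ' : HasFDerivAt φ (fderiv ℝ φ 0) 0 :=
    (hφ₀.differentiableAt (by simp)).hasFDerivAt
  let e : EuclideanSpace ℝ (Fin 2) ≃L[ℝ] EuclideanSpace ℝ (Fin 2) :=
    (fderiv ℝ φ 0).toContinuousLinearEquivOfDetNeZero hdet.ne'
  have he : (e : EuclideanSpace ℝ (Fin 2) →L[ℝ] EuclideanSpace ℝ (Fin 2)) = fderiv ℝ φ 0 :=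
    ContinuousLinearMap.coe_toContinuousLinearEquivOfDetNeZero _ _
  obtain ⟨Φ₁, hΦ₁, h₁⟩ := mem_extendableUnits_of_det_pos e.toUnit (by
    change 0 < (e : EuclideanSpace ℝ (Fin 2) →L[ℝ] EuclideanSpace ℝ (Fin 2)).det
    rwa [he])
  have hψ' : HasFDerivAt (fun x => e.symm (φ x)) (ContinuousLinearMap.id ℝ _) 0 := by
    rw [← he] at hφ'
    simpa using! e.symm.hasFDerivAt.comp 0 hφ'
  obtain ⟨Φ₂, hΦ₂, h₂⟩ := exists_compactDiffeo_of_fderiv_eq_id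
    hU h0U (e.symm.contDiff.comp_contDiffOn hφs) (by simp [hφ0]) hψ'
  obtain ⟨hs, hs', h0, hc⟩ := mem_compactDiffeo.1 (mul_mem hΦ₁ hΦ₂)
  refine ⟨Φ₁ * Φ₂, hs, hs', h0, hc, ?_⟩
  have hlim : Tendsto (fun x => e.symm (φ x)) (𝓝 0) (𝓝 0) := by
    simpa [ContinuousAt, hφ0] using hψ'.continuousAt
  have hev : ∀ᶠ x in 𝓝 0, (Φ₁ * Φ₂) x = φ x := by
    filter_upwards [h₂, hlim.eventually h₁] with x hx₂ hx₁
    rw [Equiv.Perm.mul_apply, hx₂]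
    exact hx₁.trans (e.apply_symm_apply _)
  obtain ⟨V, hV, hVo, hV0⟩ := _root_.eventually_nhds_iff.1 hev
  exact ⟨V, hVo, hV0, hV⟩
end
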